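/- Let α ∈ (0,1) and λ ≥ 0. The Mittag-Leffler function satisfies 0 ≤ E_α(-λ tᵅ) ≤ 1 for all t ≥ 0, and t ↦ E_α(-λ tᵅ) is completely monotone on (0,∞). -/

import Mathlib

open Set

/-- The one-parameter Mittag-Leffler function `E_α(z) = Σ_{j≥0} z^j / Γ(αj+1)`. -/
noncomputable def mittagLeffler (α z : ℝ) : ℝ :=
  ∑' j : ℕ, z ^ j / Real.Gamma (α * j + 1)

open Filter Topology MeasureTheory

/-- A sequence whose associated linear functional is nonnegative on every polynomial that is
nonnegative on `[0, ∞)`. -/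
def IsPositiveSeq (b : ℕ → ℝ) : Prop :=
  ∀ (n : ℕ) (p : ℕ → ℝ), (∀ y : ℝ, 0 ≤ y → 0 ≤ ∑ i ∈ Finset.range n, p i * y ^ i) →
    0 ≤ ∑ i ∈ Finset.range n, p i * b i

namespace IsPositiveSeq

variable {b : ℕ → ℝ}

theorem one : IsPositiveSeq (fun _ => 1) := by
  intro n p hp
  simpa using hp 1 zero_le_one

theorem geom_mul (hb : IsPositiveSeq b) {c : ℝ} (hc : 0 ≤ c) :
    IsPositiveSeq (fun i => c ^ i * b i) := by
  intro n p hp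
  have := hb n (fun i => p i * c ^ i) fun y hy => by
    simpa [mul_pow, mul_assoc] using hp (c * y) (by positivity)
  simpa [mul_assoc] using this

theorem shift (hb : IsPositiveSeq b) : IsPositiveSeq (fun i => b (i + 1)) := by
  intro n p hp
  have := hb (n + 1) (fun i => if i = 0 then 0 else p (i - 1)) fun y hy => by
    rw [Finset.sum_range_succ']
    have h := mul_nonneg hy (hp y hy)
    rw [Finset.mul_sum] at h
    simpa [pow_succ, mul_comm, mul_left_comm] using h
  rw [Finset.sum_range_succ'] at this
  simpa using this

theorem mul_ratio (hb : IsPositiveSeq b) {α : ℝ} (h0 : 0 ≤ α) (h1 : α ≤ 1) (k : ℕ) :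
    IsPositiveSeq (fun i => b i * ((1 + α * i + k) / (1 + i + k))) := by
  intro n p hp
  have h2 := hb n (fun i => p i * ((k + 1) / (1 + i + k))) fun y hy => by
    have hint : ∫ x in (0 : ℝ)..1, (k + 1) * ∑ i ∈ Finset.range n, p i * y ^ i * x ^ (i + k)
        = ∑ i ∈ Finset.range n, p i * ((k + 1) / (1 + i + k)) * y ^ i := by
      rw [intervalIntegral.integral_const_mul, intervalIntegral.integral_finsetSum]
      · rw [Finset.mul_sum]
        refine Finset.sum_congr rfl fun i _ => ?_
        rw [intervalIntegral.integral_const_mul, integral_pow]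
        push_cast
        simp only [one_pow, ne_eq, Nat.add_eq_zero_iff, one_ne_zero, and_false,
          not_false_eq_true, zero_pow, sub_zero]
        field_simp
        ring
      · intro i _
        exact (by fun_prop : Continuous fun x : ℝ => p i * y ^ i * x ^ (i + k)).intervalIntegrable
          _ _
    rw [← hint]
    refine intervalIntegral.integral_nonneg zero_le_one fun x hx => ?_
    have h := mul_nonneg (pow_nonneg hx.1 k) (hp (x * y) (mul_nonneg hx.1 hy))
    refine mul_nonneg (by positivity) (h.trans_eq ?_)
    rw [Finset.mul_sum]
    refine Finset.sum_congr rfl fun i _ => ?_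
    ring
  have h3 := add_nonneg (mul_nonneg h0 (hb n p hp)) (mul_nonneg (sub_nonneg.2 h1) h2)
  refine h3.trans_eq ?_
  rw [Finset.mul_sum, Finset.mul_sum, ← Finset.sum_add_distrib]
  refine Finset.sum_congr rfl fun i _ => ?_
  have : (1 + i + k : ℝ) ≠ 0 := by positivity
  field_simp
  ring

theorem prod_ratio {α : ℝ} (h0 : 0 ≤ α) (h1 : α ≤ 1) (n : ℕ) :
    IsPositiveSeq (fun i => ∏ k ∈ Finset.range n, ((1 + α * i + k) / (1 + i + k))) := by
  induction n with
  | zero => simpa using one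
  | succ n ih =>
    simp only [Finset.prod_range_succ]
    exact ih.mul_ratio h0 h1 n

theorem of_tendsto {a : ℕ → ℕ → ℝ} (ha : ∀ᶠ n in atTop, IsPositiveSeq (a n))
    (h : ∀ i, Tendsto (fun n => a n i) atTop (𝓝 (b i))) : IsPositiveSeq b := by
  intro n p hp
  have : Tendsto (fun m => ∑ i ∈ Finset.range n, p i * a m i) atTop
      (𝓝 (∑ i ∈ Finset.range n, p i * b i)) :=
    tendsto_finsetSum _ fun i _ => (h i).const_mul _
  exact ge_of_tendsto this (ha.mono fun m hm => hm n p hp)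

/-- Euler's limit formula exhibits `j! / Γ(αj+1)` as a limit of products of positive sequences. -/
theorem gamma_ratio {α : ℝ} (h0 : 0 ≤ α) (h1 : α ≤ 1) :
    IsPositiveSeq (fun i => (i.factorial : ℝ) / Real.Gamma (α * i + 1)) := by
  refine of_tendsto (a := fun n i => Real.GammaSeq (1 + i) n / Real.GammaSeq (1 + α * i) n)
    ?_ fun i => ?_
  · filter_upwards [eventually_gt_atTop 0] with n hn
    have hn' : (0 : ℝ) < n := by exact_mod_cast hn
    convert (prod_ratio h0 h1 (n + 1)).geom_mul (c := (n : ℝ) ^ (1 - α)) (by positivity) using 2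
      with i
    rw [Finset.prod_div_distrib, Real.GammaSeq, Real.GammaSeq, ← Real.rpow_natCast,
      ← Real.rpow_mul hn'.le]
    have hp : ∏ k ∈ Finset.range (n + 1), (1 + i + k : ℝ) ≠ 0 :=
      Finset.prod_ne_zero_iff.2 fun k _ => by positivity
    have hq : ∏ k ∈ Finset.range (n + 1), (1 + α * i + k : ℝ) ≠ 0 :=
      Finset.prod_ne_zero_iff.2 fun k _ => by positivity
    have hs : (n : ℝ) ^ (1 + i : ℝ) = n ^ ((1 - α) * i) * n ^ (1 + α * i) := by
      rw [← Real.rpow_add hn']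
      congr 1
      ring
    have hf : (n.factorial : ℝ) ≠ 0 := by positivity
    have hr : (n : ℝ) ^ (1 + α * i) ≠ 0 := by positivity
    rw [hs]
    field_simp
  · have hg := (Real.GammaSeq_tendsto_Gamma (1 + i)).div
      (Real.GammaSeq_tendsto_Gamma (1 + α * i)) (Real.Gamma_pos_of_pos (by positivity)).ne'
    rw [add_comm (1 : ℝ) i, Real.Gamma_nat_eq_factorial, add_comm 1 (α * i : ℝ)] at hg
    simpa only [add_comm, Pi.div_def] using hg

end IsPositiveSeq

theorem exp_neg_taylor_remainder_nonneg (n : ℕ) {y : ℝ} (hy : 0 ≤ y) :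
    0 ≤ (-1) ^ n * (Real.exp (-y) - ∑ j ∈ Finset.range n, (-y) ^ j / j.factorial) := by
  induction n generalizing y with
  | zero => simpa using (Real.exp_pos _).le
  | succ n ih =>
    let f : ℝ → ℝ := fun y =>
      (-1) ^ (n + 1) * (Real.exp (-y) - ∑ j ∈ Finset.range (n + 1), (-y) ^ j / j.factorial)
    have hd : ∀ y, HasDerivAt f
        ((-1) ^ n * (Real.exp (-y) - ∑ j ∈ Finset.range n, (-y) ^ j / j.factorial)) y := by
      intro y
      have hs : HasDerivAt (fun y : ℝ => ∑ j ∈ Finset.range (n + 1), (-y) ^ j / j.factorial)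
          (∑ j ∈ Finset.range (n + 1), (j * (-y) ^ (j - 1) * -1) / j.factorial) y :=
        HasDerivAt.fun_sum fun j _ => (((hasDerivAt_id y).neg.pow j).div_const _)
      convert! (((hasDerivAt_id y).neg.exp).sub hs).const_mul ((-1 : ℝ) ^ (n + 1)) using 1
      rw [Finset.sum_range_succ']
      have : ∀ j : ℕ, ((j + 1 : ℕ) : ℝ) * (-y) ^ (j + 1 - 1) * -1 / ((j + 1).factorial : ℝ)
          = -((-y) ^ j / j.factorial) := by
        intro j
        rw [Nat.factorial_succ]
        push_cast
        have : (j.factorial : ℝ) ≠ 0 := by positivity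
        have : (j + 1 : ℝ) ≠ 0 := by positivity
        field_simp
      simp only [this, Finset.sum_neg_distrib]
      simp [pow_succ]
      ring
    have hm : MonotoneOn f (Ici 0) := by
      refine monotoneOn_of_deriv_nonneg (convex_Ici 0)
        (fun y _ => (hd y).continuousAt.continuousWithinAt)
        (fun y _ => (hd y).differentiableAt.differentiableWithinAt) fun y hy => ?_
      rw [(hd y).deriv]
      rw [interior_Ici] at hy
      exact ih (le_of_lt hy)
    have h := hm self_mem_Ici hy hy
    have h0 : f 0 = 0 := by
      simp [f, Finset.sum_range_succ']
    exact h0 ▸ h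

/-- The exponential generating series of a sequence, evaluated at `-y`. -/
noncomputable def expSeries (b : ℕ → ℝ) (y : ℝ) : ℝ :=
  ∑' j : ℕ, b j * ((-y) ^ j / j.factorial)

/-- The exponential generating series of `b` has infinite radius of convergence. -/
def IsEntireSeq (b : ℕ → ℝ) : Prop :=
  ∀ R : ℝ, 0 ≤ R → Summable fun j : ℕ => |b j| * (R ^ j / j.factorial)

namespace IsEntireSeq

variable {b : ℕ → ℝ}

theorem summable (hb : IsEntireSeq b) (y : ℝ) :
    Summable fun j : ℕ => b j * ((-y) ^ j / j.factorial) := by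
  refine Summable.of_norm ?_
  simpa [abs_mul, abs_div] using hb |y| (abs_nonneg y)

theorem shift (hb : IsEntireSeq b) : IsEntireSeq (fun j => b (j + 1)) := by
  intro R hR
  refine Summable.of_nonneg_of_le (fun j => by positivity) (fun j => ?_)
    ((summable_nat_add_iff 1).2 (hb (2 * R + 1) (by positivity)))
  refine mul_le_mul_of_nonneg_left ?_ (abs_nonneg _)
  have h1 : ((j : ℝ) + 1) ≤ 2 ^ j := by exact_mod_cast Nat.lt_two_pow_self (n := j)
  have h2 : (2 * R) ^ j ≤ (2 * R + 1) ^ (j + 1) :=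
    (pow_le_pow_left₀ (by positivity) (by linarith) j).trans
      (pow_le_pow_right₀ (by linarith) (Nat.le_succ j))
  rw [Nat.factorial_succ, div_le_div_iff₀ (by positivity) (by positivity)]
  push_cast
  have h3 : R ^ j * (j + 1) ≤ (2 * R + 1) ^ (j + 1) := by
    refine le_trans ?_ h2
    rw [mul_pow, mul_comm]
    gcongr
  calc R ^ j * ((j + 1) * j.factorial) = R ^ j * (j + 1) * j.factorial := by ring
    _ ≤ _ := by gcongr

theorem hasDerivAt_expSeries (hb : IsEntireSeq b) (y : ℝ) :
    HasDerivAt (expSeries b) (-expSeries (fun j => b (j + 1)) y) y := by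
  have hterm : ∀ (j : ℕ) (z : ℝ), b (j + 1) * (((j + 1 : ℕ) : ℝ) * (-z) ^ (j + 1 - 1) * -1
      / (j + 1).factorial) = -(b (j + 1) * ((-z) ^ j / j.factorial)) := by
    intro j z
    rw [Nat.factorial_succ]
    push_cast
    have : (j.factorial : ℝ) ≠ 0 := by positivity
    have : (j + 1 : ℝ) ≠ 0 := by positivity
    field_simp
  have hbound : Summable fun j : ℕ =>
      |b j| * (j * (|y| + 1) ^ (j - 1) / j.factorial) := by
    rw [← summable_nat_add_iff 1]
    refine (hb.shift (|y| + 1) (by positivity)).congr fun j => ?_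
    rw [Nat.factorial_succ]
    push_cast
    have : (j.factorial : ℝ) ≠ 0 := by positivity
    have : (j + 1 : ℝ) ≠ 0 := by positivity
    field_simp
  have hderiv : ∀ (j : ℕ) (z : ℝ), HasDerivAt (fun z => b j * ((-z) ^ j / j.factorial))
      (b j * (j * (-z) ^ (j - 1) * -1 / j.factorial)) z := fun j z =>
    (((hasDerivAt_neg z).fun_pow j).div_const _).const_mul _
  have hd := hasDerivAt_tsum_of_isPreconnected
    (g := fun j z => b j * ((-z) ^ j / j.factorial))
    (g' := fun j z => b j * (j * (-z) ^ (j - 1) * -1 / j.factorial))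
    (y₀ := y) (y := y) hbound Metric.isOpen_ball
    (convex_ball (0 : ℝ) (|y| + 1)).isPreconnected
    (fun j z _ => hderiv j z)
    (fun j z hz => by
      have hz' : |z| ≤ |y| + 1 := by simpa using (mem_ball_zero_iff.1 hz).le
      simp only [Real.norm_eq_abs, abs_mul, abs_div, abs_pow, abs_neg, abs_one, mul_one,
        Nat.abs_cast]
      gcongr)
    (by simp) (hb.summable y) (by simp)
  refine hd.congr_deriv ?_
  have hs : Summable fun j : ℕ => b (j + 1) * (((j + 1 : ℕ) : ℝ) * (-y) ^ (j + 1 - 1) * -1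
      / (j + 1).factorial) := by
    simpa only [hterm] using (hb.shift.summable y).neg
  have hs' : Summable fun j : ℕ => b j * (j * (-y) ^ (j - 1) * -1 / j.factorial) := by
    rw [← summable_nat_add_iff 1]
    exact hs
  rw [hs'.tsum_eq_zero_add]
  simp only [hterm, tsum_neg, expSeries]
  simp

theorem tendsto_partialSum (hb : IsEntireSeq b) (y : ℝ) :
    Tendsto (fun n => ∑ j ∈ Finset.range n, (-y) ^ j / j.factorial * b j) atTop
      (𝓝 (expSeries b y)) := by
  simpa only [mul_comm, expSeries] using (hb.summable y).hasSum.tendsto_sum_nat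

theorem expSeries_nonneg (hb : IsEntireSeq b) (hp : IsPositiveSeq b) {y : ℝ} (hy : 0 ≤ y) :
    0 ≤ expSeries b y := by
  have h2 : Tendsto (fun n : ℕ => 2 * n + 1) atTop atTop :=
    tendsto_atTop_mono (fun n => by simp only [id]; lia) tendsto_id
  refine ge_of_tendsto' ((hb.tendsto_partialSum y).comp h2) fun n => hp _ _ fun z hz => ?_
  have h := exp_neg_taylor_remainder_nonneg (2 * n + 1) (mul_nonneg hy hz)
  have he := Real.exp_pos (-(y * z))
  have hodd : (-1 : ℝ) ^ (2 * n + 1) = -1 := by simp [pow_succ, pow_mul]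
  rw [hodd] at h
  have : ∑ j ∈ Finset.range (2 * n + 1), (-(y * z)) ^ j / j.factorial
      = ∑ j ∈ Finset.range (2 * n + 1), (-y) ^ j / j.factorial * z ^ j :=
    Finset.sum_congr rfl fun j _ => by rw [← neg_mul, mul_pow]; ring
  linarith

theorem expSeries_le (hb : IsEntireSeq b) (hp : IsPositiveSeq b) {y : ℝ} (hy : 0 ≤ y) :
    expSeries b y ≤ b 0 := by
  have h2 : Tendsto (fun n : ℕ => 2 * n + 2) atTop atTop :=
    tendsto_atTop_mono (fun n => by simp only [id]; lia) tendsto_id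
  refine le_of_tendsto' ((hb.tendsto_partialSum y).comp h2) fun n => ?_
  have key := hp (2 * n + 2)
    (fun j => (if j = 0 then 1 else 0) - (-y) ^ j / j.factorial) fun z hz => by
      have h := exp_neg_taylor_remainder_nonneg (2 * n + 2) (mul_nonneg hy hz)
      have he : Real.exp (-(y * z)) ≤ 1 := Real.exp_le_one_iff.2 (by nlinarith)
      have heven : (-1 : ℝ) ^ (2 * n + 2) = 1 := by simp [pow_succ, pow_mul]
      rw [heven] at h
      have : ∑ j ∈ Finset.range (2 * n + 2), (-(y * z)) ^ j / j.factorial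
          = ∑ j ∈ Finset.range (2 * n + 2), (-y) ^ j / j.factorial * z ^ j :=
        Finset.sum_congr rfl fun j _ => by rw [← neg_mul, mul_pow]; ring
      simp only [sub_mul, Finset.sum_sub_distrib, ite_mul, one_mul, zero_mul,
        Finset.sum_ite_eq', Finset.mem_range]
      simp only [Nat.zero_lt_succ, if_true, pow_zero]
      linarith
  simp only [sub_mul, Finset.sum_sub_distrib, ite_mul, one_mul, zero_mul,
    Finset.sum_ite_eq', Finset.mem_range] at key
  simp only [Nat.zero_lt_succ, if_true] at key
  simp only [Function.comp_apply]
  linarith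

end IsEntireSeq

theorem rpow_mul_exp_neg_le_Gamma {M x : ℝ} (hM : 0 ≤ M) (hx : 0 ≤ x) :
    M ^ x * Real.exp (-M) ≤ Real.Gamma (x + 1) := by
  have hi := Real.GammaIntegral_convergent (s := x + 1) (by positivity)
  rw [Real.Gamma_eq_integral (by positivity), ← integral_exp_neg_Ioi, ← integral_const_mul]
  refine le_trans ?_ (setIntegral_mono_set hi ?_ (Ioi_subset_Ioi hM).eventuallyLE)
  · refine setIntegral_mono_on ((integrableOn_exp_neg_Ioi M).const_mul _)
      (hi.mono_set (Ioi_subset_Ioi hM)) measurableSet_Ioi fun t ht => ?_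
    rw [mul_comm, add_sub_cancel_right]
    have : M ≤ t := le_of_lt ht
    gcongr
  · refine (ae_restrict_iff' measurableSet_Ioi).2 (Eventually.of_forall fun t ht => ?_)
    have : (0 : ℝ) < t := ht
    simp only [Pi.zero_apply]
    positivity

theorem isEntireSeq_gamma_ratio {α : ℝ} (h0 : 0 < α) :
    IsEntireSeq (fun i => (i.factorial : ℝ) / Real.Gamma (α * i + 1)) := by
  intro R hR
  set M : ℝ := (2 * R + 1) ^ (1 / α) with hM
  have hMp : 0 < M := by positivity
  have hMα : M ^ α = 2 * R + 1 := by
    rw [hM, ← Real.rpow_mul (by positivity), one_div_mul_cancel h0.ne', Real.rpow_one]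
  have hq : R / (2 * R + 1) < 1 := by
    rw [div_lt_one (by positivity)]
    linarith
  refine Summable.of_nonneg_of_le (fun j => by positivity) (fun j => ?_)
    ((summable_geometric_of_lt_one (by positivity) hq).mul_left (Real.exp M))
  have hg := rpow_mul_exp_neg_le_Gamma hMp.le (x := α * j) (by positivity)
  have hG : 0 < Real.Gamma (α * j + 1) := Real.Gamma_pos_of_pos (by positivity)
  rw [Real.rpow_mul hMp.le, hMα, Real.rpow_natCast, Real.exp_neg] at hg
  have hf : (j.factorial : ℝ) ≠ 0 := by positivity
  rw [abs_of_pos (by positivity)]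
  calc (j.factorial : ℝ) / Real.Gamma (α * j + 1) * (R ^ j / j.factorial)
      = R ^ j / Real.Gamma (α * j + 1) := by field_simp
    _ ≤ R ^ j / ((2 * R + 1) ^ j * (Real.exp M)⁻¹) := by gcongr
    _ = Real.exp M * (R / (2 * R + 1)) ^ j := by rw [div_pow]; field_simp

theorem mittagLeffler_neg_eq_expSeries (α y : ℝ) :
    mittagLeffler α (-y)
      = expSeries (fun i => (i.factorial : ℝ) / Real.Gamma (α * i + 1)) y := by
  refine tsum_congr fun j => ?_
  have : (j.factorial : ℝ) ≠ 0 := by positivity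
  field_simp

/-- The convex cone generated by the functions `t ↦ t ^ a * f (l * t ^ α)` with `a ≤ 0` and
`f` the exponential series of a positive sequence. -/
inductive RelaxationCone (α l : ℝ) : (ℝ → ℝ) → Prop
  | of {a : ℝ} {b : ℕ → ℝ} (ha : a ≤ 0) (hb : IsEntireSeq b) (hp : IsPositiveSeq b) :
      RelaxationCone α l (fun t => t ^ a * expSeries b (l * t ^ α))
  | add {f g : ℝ → ℝ} (hf : RelaxationCone α l f) (hg : RelaxationCone α l g) :
      RelaxationCone α l (fun t => f t + g t)
  | smul {c : ℝ} {f : ℝ → ℝ} (hc : 0 ≤ c) (hf : RelaxationCone α l f) :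
      RelaxationCone α l (fun t => c * f t)

namespace RelaxationCone

variable {α l : ℝ} {f : ℝ → ℝ}

theorem nonneg (hl : 0 ≤ l) (hf : RelaxationCone α l f) {t : ℝ} (ht : 0 < t) : 0 ≤ f t := by
  induction hf with
  | of ha hb hp => exact mul_nonneg (by positivity) (hb.expSeries_nonneg hp (by positivity))
  | add _ _ hf hg => exact add_nonneg hf hg
  | smul hc _ hf => exact mul_nonneg hc hf

theorem exists_hasDerivAt (hα : α ∈ Icc (0 : ℝ) 1) (hl : 0 ≤ l) (hf : RelaxationCone α l f) :
    ∃ g, RelaxationCone α l g ∧ ∀ t > 0, HasDerivAt f (-g t) t := by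
  induction hf with
  | @of a b ha hb hp =>
    refine ⟨_, .add (.smul (neg_nonneg.2 ha) (.of (a := a - 1) (by linarith) hb hp))
      (.smul (mul_nonneg hl hα.1) (.of (a := a + (α - 1)) (by linarith [hα.2]) hb.shift hp.shift)),
      fun t ht => ?_⟩
    have h1 := Real.hasDerivAt_rpow_const (x := t) (p := a) (Or.inl ht.ne')
    have h2 := (Real.hasDerivAt_rpow_const (x := t) (p := α) (Or.inl ht.ne')).const_mul l
    refine (h1.mul ((hb.hasDerivAt_expSeries (l * t ^ α)).comp t h2)).congr_deriv ?_
    rw [Real.rpow_add ht]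
    simp only [Function.comp_apply]
    ring
  | add _ _ hf hg =>
    obtain ⟨f', hf', hdf⟩ := hf
    obtain ⟨g', hg', hdg⟩ := hg
    exact ⟨_, .add hf' hg', fun t ht => ((hdf t ht).add (hdg t ht)).congr_deriv (by ring)⟩
  | smul hc _ hf =>
    obtain ⟨f', hf', hdf⟩ := hf
    exact ⟨_, .smul hc hf', fun t ht => ((hdf t ht).const_mul _).congr_deriv (by ring)⟩

theorem exists_iteratedDeriv (hα : α ∈ Icc (0 : ℝ) 1) (hl : 0 ≤ l)
    (hf : RelaxationCone α l f) (j : ℕ) :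
    ∃ g, RelaxationCone α l g ∧ ∀ t > 0, iteratedDeriv j f t = (-1) ^ j * g t := by
  induction j with
  | zero => exact ⟨f, hf, by simp⟩
  | succ j ih =>
    obtain ⟨g, hg, hj⟩ := ih
    obtain ⟨g', hg', hd⟩ := hg.exists_hasDerivAt hα hl
    refine ⟨g', hg', fun t ht => ?_⟩
    have he : iteratedDeriv j f =ᶠ[𝓝 t] fun s => (-1) ^ j * g s := by
      filter_upwards [lt_mem_nhds ht] with s hs using hj s hs
    rw [iteratedDeriv_succ, he.deriv_eq, ((hd t ht).const_mul _).deriv]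
    ring

end RelaxationCone

/-- For `α ∈ (0,1)` and `λ ≥ 0`, `0 ≤ E_α(-λtᵅ) ≤ 1` for `t ≥ 0`, and
`t ↦ E_α(-λtᵅ)` is completely monotone on `(0,∞)`. -/
theorem mittagLeffler_relaxation_properties (α : ℝ) (hα : α ∈ Ioo (0:ℝ) 1)
    (l : ℝ) (hl : 0 ≤ l) :
    (∀ t : ℝ, 0 ≤ t →
      0 ≤ mittagLeffler α (-l * t ^ α) ∧ mittagLeffler α (-l * t ^ α) ≤ 1) ∧
    (∀ j : ℕ, ∀ t > (0:ℝ),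
      0 ≤ (-1 : ℝ) ^ j *
        iteratedDeriv j (fun s : ℝ => mittagLeffler α (-l * s ^ α)) t) := by
  have hp := IsPositiveSeq.gamma_ratio hα.1.le hα.2.le
  have hb := isEntireSeq_gamma_ratio hα.1
  simp only [neg_mul, mittagLeffler_neg_eq_expSeries]
  refine ⟨fun t ht => ⟨hb.expSeries_nonneg hp (by positivity), ?_⟩, fun j t ht => ?_⟩
  · simpa using hb.expSeries_le hp (y := l * t ^ α) (by positivity)
  · obtain ⟨g, hg, hj⟩ := (RelaxationCone.of (α := α) (l := l) le_rfl hb hp).exists_iteratedDeriv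
      ⟨hα.1.le, hα.2.le⟩ hl j
    simp only [Real.rpow_zero, one_mul] at hj
    rw [hj t ht, ← mul_assoc, ← mul_pow]
    simpa using hg.nonneg hl ht
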